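/- In the minimum-counterexample setup, let q and q' be the two neighbors of x of degree at least 3 in G. Then for every acyclic edge coloring c of G−xy using Δ+1 colors, S_xq(c) = S_xq'(c) = S_{yy'}(c) = C − F''_x(c); in particular deg_G(q) = deg_G(q') = deg_G(y') = Δ. (Here, for an edge ab colored by c, S_ab(c) denotes the set of colors assigned by c to the edges incident with b other than ab.) -/

import Mathlib

open SimpleGraph

namespace AEC

variable {V : Type*}

/-- The set of colors appearing (under partial coloring `c`) on colored edges incident
with the vertex `u` (i.e. `F_u`). -/
def colorsAt (G : SimpleGraph V) (c : Sym2 V → Option ℕ) (u : V) : Set ℕ :=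
  {γ | ∃ z, G.Adj u z ∧ c s(u, z) = some γ}

/-- `S_ab`: the set of colors appearing on the colored edges incident with `b`
other than the edge `ab`. -/
def Sset (G : SimpleGraph V) (c : Sym2 V → Option ℕ) (a b : V) : Set ℕ :=
  {γ | ∃ z, G.Adj b z ∧ z ≠ a ∧ c s(b, z) = some γ}

/-- A partial edge coloring (colors are `ℕ`, `none` = uncolored): it may only color
edges of `G`, and colored edges sharing an endpoint receive distinct colors. -/
def ProperPartialColoring (G : SimpleGraph V) (c : Sym2 V → Option ℕ) : Prop :=
  (∀ e, (c e).isSome → e ∈ G.edgeSet) ∧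
  ∀ ⦃u v w : V⦄, G.Adj u v → G.Adj u w → v ≠ w → (c s(u, v)).isSome →
    c s(u, v) ≠ c s(u, w)

/-- A valid (acyclic) partial coloring: proper, and no cycle of `G` is bichromatic,
i.e. no cycle has all of its edges colored using only two colors. -/
def AcyclicPartialColoring (G : SimpleGraph V) (c : Sym2 V → Option ℕ) : Prop :=
  ProperPartialColoring G c ∧
  ∀ (α β : ℕ) (v : V) (W : G.Walk v v), W.IsCycle →
    ¬ ∀ e ∈ W.edges, c e = some α ∨ c e = some β

/-- An acyclic edge coloring of `G` using (at most) `k` colors: a valid partial coloring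
that colors every edge of `G` with a color `< k`. -/
def IsAcyclicEdgeColoring (G : SimpleGraph V) (k : ℕ) (c : Sym2 V → Option ℕ) : Prop :=
  AcyclicPartialColoring G c ∧ ∀ e ∈ G.edgeSet, ∃ a, a < k ∧ c e = some a

/-- `G` is 2-degenerate: every nonempty (induced) subgraph has a vertex of degree at most 2. -/
def TwoDegenerate [DecidableEq V] (G : SimpleGraph V) [DecidableRel G.Adj] : Prop :=
  ∀ s : Finset V, s.Nonempty → ∃ v ∈ s, (s.filter fun u => G.Adj v u).card ≤ 2

/-- A maximal `(α,β)`-bichromatic path from `a` to `b`: a path all of whose edges are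
colored `α` or `β`, which cannot be extended at either end. -/
def IsMaximalBichromaticPath (G : SimpleGraph V) (c : Sym2 V → Option ℕ)
    (α β : ℕ) {a b : V} (W : G.Walk a b) : Prop :=
  W.IsPath ∧ (∀ e ∈ W.edges, c e = some α ∨ c e = some β) ∧
  (∀ w, G.Adj a w → (c s(a, w) = some α ∨ c s(a, w) = some β) → w ∈ W.support) ∧
  (∀ w, G.Adj b w → (c s(b, w) = some α ∨ c s(b, w) = some β) → w ∈ W.support)

/-- An `(α,β,a,b)`-maximal bichromatic path: a maximal `(α,β)`-bichromatic path from
`a` to `b` whose edge incident on `a` is colored `α`. -/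
def IsMaxBichromaticPathFrom (G : SimpleGraph V) (c : Sym2 V → Option ℕ)
    (α β : ℕ) {a b : V} (W : G.Walk a b) : Prop :=
  IsMaximalBichromaticPath G c α β W ∧ ∃ e, W.edges.head? = some e ∧ c e = some α

/-- An `(α,β,ab)`-critical path: a maximal `(α,β)`-bichromatic path from `a` to `b` whose
edges incident on `a` and on `b` are both colored `α`. -/
def IsCriticalPath (G : SimpleGraph V) (c : Sym2 V → Option ℕ)
    (α β : ℕ) {a b : V} (W : G.Walk a b) : Prop :=
  IsMaxBichromaticPathFrom G c α β W ∧ ∃ e, W.edges.getLast? = some e ∧ c e = some α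

/-- `F''_x(c)`: colors of edges from `x` to its neighbors (other than `y`) of degree ≥ 3. -/
def Fpp [Fintype V] (G : SimpleGraph V) [DecidableRel G.Adj]
    (c : Sym2 V → Option ℕ) (x y : V) : Set ℕ :=
  {γ | ∃ z, G.Adj x z ∧ z ≠ y ∧ 3 ≤ G.degree z ∧ c s(x, z) = some γ}

/-- `F'_x(c)`: colors of edges from `x` to its neighbors (other than `y`) of degree 2. -/
def Fp [Fintype V] (G : SimpleGraph V) [DecidableRel G.Adj]
    (c : Sym2 V → Option ℕ) (x y : V) : Set ℕ :=
  {γ | ∃ z, G.Adj x z ∧ z ≠ y ∧ G.degree z = 2 ∧ c s(x, z) = some γ}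

/-- `F_x(c) = F'_x(c) ∪ F''_x(c)`. -/
def Fx [Fintype V] (G : SimpleGraph V) [DecidableRel G.Adj]
    (c : Sym2 V → Option ℕ) (x y : V) : Set ℕ :=
  Fp G c x y ∪ Fpp G c x y

/-- The graph of all edges colored `a` or `b`. -/
def bichrom (c : Sym2 V → Option ℕ) (a b : ℕ) : SimpleGraph V :=
  fromEdgeSet {e | c e = some a ∨ c e = some b}

theorem bichrom_adj {c : Sym2 V → Option ℕ} {a b : ℕ} {u v : V} :
    (bichrom c a b).Adj u v ↔ (c s(u, v) = some a ∨ c s(u, v) = some b) ∧ u ≠ v :=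
  fromEdgeSet_adj _

theorem bichrom_comm (c : Sym2 V → Option ℕ) (a b : ℕ) : bichrom c a b = bichrom c b a := by
  simp only [bichrom, or_comm]

/-- An acyclic edge coloring with colors `< k` of the graph formed by the colored edges. -/
structure IsAcyclicColoring (k : ℕ) (c : Sym2 V → Option ℕ) : Prop where
  loopless : ∀ u, c s(u, u) = none
  lt : ∀ {e a}, c e = some a → a < k
  inj : ∀ {u v w a}, c s(u, v) = some a → c s(u, w) = some a → v = w
  acyclic : ∀ a b, (bichrom c a b).IsAcyclic

theorem isAcyclicEdgeColoring_iff {G : SimpleGraph V} {k : ℕ} {c : Sym2 V → Option ℕ} :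
    IsAcyclicEdgeColoring G k c ↔
      IsAcyclicColoring k c ∧ ∀ e, (c e).isSome ↔ e ∈ G.edgeSet := by
  constructor
  · rintro ⟨⟨⟨hdom, hprop⟩, hcyc⟩, hall⟩
    have hiff : ∀ e, (c e).isSome ↔ e ∈ G.edgeSet := fun e =>
      ⟨hdom e, fun he => by obtain ⟨a, -, ha⟩ := hall e he; simp [ha]⟩
    have hadj : ∀ {u v a}, c s(u, v) = some a → G.Adj u v := fun {u v a} h =>
      (hiff s(u, v)).1 (by simp [h])
    refine ⟨⟨fun u => ?_, fun {e a} h => ?_, fun {u v w a} h1 h2 => ?_, fun a b v W hW => ?_⟩,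
      hiff⟩
    · rcases h : c s(u, u) with _ | a
      · rfl
      · exact absurd (hadj h) (G.loopless.irrefl u)
    · obtain ⟨a', ha', h'⟩ := hall e ((hiff e).1 (by simp [h]))
      grind
    · by_contra hne
      exact hprop (hadj h1) (hadj h2) hne (by simp [h1]) (by rw [h1, h2])
    · have hle : bichrom c a b ≤ G := fun u v h => (bichrom_adj.1 h).1.elim hadj hadj
      refine hcyc a b v (W.mapLe hle) (hW.mapLe hle) fun e he => ?_
      rw [Walk.edges_mapLe_eq_edges] at he
      have := W.edges_subset_edgeSet he
      rw [bichrom, edgeSet_fromEdgeSet] at this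
      exact this.1
  · rintro ⟨h, hiff⟩
    refine ⟨⟨⟨fun e he => (hiff e).1 he, fun u v w hv hw hne hs heq => ?_⟩,
      fun a b v W hW hcol => ?_⟩, fun e he => ?_⟩
    · obtain ⟨a, ha⟩ := Option.isSome_iff_exists.1 hs
      exact hne (h.inj ha (heq ▸ ha))
    · have hmem : ∀ e ∈ W.edges, e ∈ (bichrom c a b).edgeSet := fun e he => by
        rw [bichrom, edgeSet_fromEdgeSet]
        exact ⟨hcol e he, G.not_isDiag_of_mem_edgeSet (W.edges_subset_edgeSet he)⟩
      exact h.acyclic a b (W.transfer _ hmem) (hW.transfer hmem)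
    · obtain ⟨a, ha⟩ := Option.isSome_iff_exists.1 ((hiff e).2 he)
      exact ⟨a, h.lt ha, ha⟩

theorem mem_of_reachable {H : SimpleGraph V} {S : Set V} (hS : ∀ u ∈ S, ∀ v, H.Adj u v → v ∈ S)
    {x y : V} (h : H.Reachable x y) (hx : x ∈ S) : y ∈ S := by
  obtain ⟨p⟩ := h
  induction p with
  | nil => exact hx
  | cons hadj _ ih => exact ih (hS _ hx _ hadj)

theorem not_reachable_of_isolated {H : SimpleGraph V} {x y : V} (hne : x ≠ y)
    (hy : ∀ v, ¬ H.Adj y v) : ¬ H.Reachable x y := fun h =>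
  hne (mem_of_reachable (S := {y}) (by rintro u rfl v hv; exact absurd hv (hy v)) h.symm rfl)

theorem exists_two_adj_of_isPath {H : SimpleGraph V} {x y : V} (p : H.Walk x y)
    (hp : p.IsPath) {u : V} (hu : u ∈ p.support) (hux : u ≠ x) (huy : u ≠ y) :
    ∃ a ∈ p.support, ∃ b ∈ p.support, a ≠ b ∧ H.Adj u a ∧ H.Adj u b := by
  induction p with
  | nil => simp_all
  | @cons x v y hadj p ih =>
    rw [Walk.cons_isPath_iff] at hp
    by_cases huv : u = v
    · subst huv
      cases p with
      | nil => exact absurd rfl huy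
      | @cons _ w _ hadj' p' =>
        refine ⟨x, by simp, w, by simp, ?_, hadj.symm, hadj'⟩
        rintro rfl
        exact hp.2 (by simp)
    · have hu' : u ∈ p.support := by simpa [hux] using hu
      obtain ⟨a, ha, b, hb, h⟩ := ih hp.1 hu' huv huy
      exact ⟨a, by simp [ha], b, by simp [hb], h⟩

/-- In a graph of maximum degree at most two, a component has at most two vertices
of degree at most one. -/
theorem not_reachable_of_three_leaves {H : SimpleGraph V}
    (hdeg : ∀ u a b d, H.Adj u a → H.Adj u b → H.Adj u d → a = b ∨ a = d ∨ b = d)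
    {x y z : V} (hxy : x ≠ y) (hxz : x ≠ z) (hyz : y ≠ z)
    (hx : ∀ a b, H.Adj x a → H.Adj x b → a = b) (hy : ∀ a b, H.Adj y a → H.Adj y b → a = b)
    (hz : ∀ a b, H.Adj z a → H.Adj z b → a = b) (h : H.Reachable x y) :
    ¬ H.Reachable x z := by
  classical
  intro hxz'
  obtain ⟨p, hp⟩ := h.exists_isPath
  have end_adj : ∀ {s t : V} (r : H.Walk s t), s ≠ t → ∃ a ∈ r.support, H.Adj s a := by
    intro s t r hst
    cases r with
    | nil => exact absurd rfl hst
    | @cons _ v _ hadj r => exact ⟨v, by simp, hadj⟩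
  have hz' : z ∈ p.support := by
    refine mem_of_reachable (S := {u | u ∈ p.support}) (fun u hu v huv => ?_) hxz'
      p.start_mem_support
    by_cases hux : u = x
    · subst hux
      obtain ⟨a, ha, hadj⟩ := end_adj p hxy
      exact hx a v hadj huv ▸ ha
    by_cases huy : u = y
    · subst huy
      obtain ⟨a, ha, hadj⟩ := end_adj p.reverse hxy.symm
      rw [Walk.support_reverse, List.mem_reverse] at ha
      exact hy a v hadj huv ▸ ha
    obtain ⟨a, ha, b, hb, hab, h1, h2⟩ := exists_two_adj_of_isPath p hp hu hux huy
    rcases hdeg u a b v h1 h2 huv with h | h | h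
    · exact absurd h hab
    · exact h ▸ ha
    · exact h ▸ hb
  obtain ⟨a, -, b, -, hab, h1, h2⟩ := exists_two_adj_of_isPath p hp hz' hxz.symm hyz.symm
  exact hab (hz a b h1 h2)

namespace IsAcyclicColoring

variable {k : ℕ} {c : Sym2 V → Option ℕ}

theorem degree_le_two (h : IsAcyclicColoring k c) (a b : ℕ) (u v w t : V)
    (hv : (bichrom c a b).Adj u v) (hw : (bichrom c a b).Adj u w)
    (ht : (bichrom c a b).Adj u t) : v = w ∨ v = t ∨ w = t := by
  have := @h.inj
  simp only [bichrom_adj] at hv hw ht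
  grind

variable [DecidableEq V]

theorem uncolor (h : IsAcyclicColoring k c) (e : Sym2 V) :
    IsAcyclicColoring k (Function.update c e none) := by
  have hle : ∀ e' a, Function.update c e none e' = some a → c e' = some a := by
    intro e' a; grind [Function.update_apply]
  refine ⟨fun u => ?_, fun h' => h.lt (hle _ _ h'),
    fun h1 h2 => h.inj (hle _ _ h1) (hle _ _ h2), fun a b => (h.acyclic a b).anti ?_⟩
  · rcases h' : Function.update c e none s(u, u) with _ | a
    · rfl
    · have := hle _ _ h'
      simp [h.loopless] at this
  · intro u v
    simp only [bichrom_adj]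
    exact fun h' => ⟨h'.1.imp (hle _ _) (hle _ _), h'.2⟩

theorem recolor_of_not_reachable (h : IsAcyclicColoring k c) {x y : V} {γ : ℕ} (hxy : x ≠ y)
    (hγ : γ < k) (hx : ∀ v, v ≠ y → c s(x, v) ≠ some γ) (hy : ∀ v, v ≠ x → c s(y, v) ≠ some γ)
    (hr : ∀ a, ¬ (bichrom (Function.update c s(x, y) none) a γ).Reachable x y) :
    IsAcyclicColoring k (Function.update c s(x, y) (some γ)) := by
  have hacyc : ∀ a, (bichrom (Function.update c s(x, y) (some γ)) a γ).IsAcyclic := by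
    intro a
    refine IsAcyclic.anti ?_
      (((h.uncolor s(x, y)).acyclic a γ).sup_edge_of_not_reachable (hr a))
    intro u v
    simp only [bichrom_adj, sup_adj, edge_adj, Function.update_apply, Sym2.eq_iff]
    grind
  refine ⟨fun u => ?_, fun {e a} h' => ?_, fun {u v w a} h1 h2 => ?_, fun a b => ?_⟩
  · have := h.loopless u
    simp only [Function.update_apply, Sym2.eq_iff]
    grind
  · have := @h.lt e a
    grind [Function.update_apply]
  · have := @h.inj u v w a
    simp only [Function.update_apply, Sym2.eq_iff] at h1 h2
    grind [Sym2.eq_swap]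
  · by_cases hb : b = γ
    · exact hb ▸ hacyc a
    by_cases ha : a = γ
    · rw [bichrom_comm]
      exact ha ▸ hacyc b
    refine (h.acyclic a b).anti ?_
    intro u v
    simp only [bichrom_adj, Function.update_apply]
    grind

theorem recolor (h : IsAcyclicColoring k c) {x y : V} {γ : ℕ} (hxy : x ≠ y)
    (hγ : γ < k) (hx : ∀ v, v ≠ y → c s(x, v) ≠ some γ) (hy : ∀ v, v ≠ x → c s(y, v) ≠ some γ)
    (hr : ∀ a v w, v ≠ x → w ≠ y → c s(y, v) = some a → c s(x, w) = some a →
      ∀ u, c s(w, u) ≠ some γ) :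
    IsAcyclicColoring k (Function.update c s(x, y) (some γ)) := by
  refine h.recolor_of_not_reachable hxy hγ hx hy fun a hreach => ?_
  by_cases h1 : ∃ v, v ≠ x ∧ c s(y, v) = some a
  · obtain ⟨v, hvx, hv⟩ := h1
    by_cases h2 : ∃ w, w ≠ y ∧ c s(x, w) = some a
    · obtain ⟨w, hwy, hw⟩ := h2
      have hclosed := mem_of_reachable (S := {x, w}) (fun u hu t hut => ?_) hreach (by simp)
      · rcases hclosed with rfl | rfl
        · exact hxy rfl
        · exact hwy rfl
      have := hr a v w hvx hwy hv hw
      have hinj := @h.inj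
      simp only [bichrom_adj, Function.update_apply, Sym2.eq_iff] at hut
      simp only [Set.mem_insert_iff, Set.mem_singleton_iff] at hu ⊢
      grind [Sym2.eq_swap]
    · refine not_reachable_of_isolated hxy.symm (fun t ht => ?_) hreach.symm
      simp only [bichrom_adj, Function.update_apply, Sym2.eq_iff] at ht
      grind
  · refine not_reachable_of_isolated hxy (fun t ht => ?_) hreach
    simp only [bichrom_adj, Function.update_apply, Sym2.eq_iff] at ht
    grind

end IsAcyclicColoring

theorem eq_or_eq_of_degree_lt_three [Fintype V] [DecidableEq V] {G : SimpleGraph V}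
    [DecidableRel G.Adj] {y a b : V} (hdeg : G.degree y < 3) (ha : G.Adj y a) (hb : G.Adj y b)
    (hab : a ≠ b) (v : V) (hv : G.Adj y v) : v = a ∨ v = b := by
  by_contra! h
  have hsub : ({v, a, b} : Finset V) ⊆ G.neighborFinset y := by
    intro w; simp only [Finset.mem_insert, Finset.mem_singleton, mem_neighborFinset]
    rintro (rfl | rfl | rfl) <;> assumption
  have := Finset.card_le_card hsub
  rw [Finset.card_eq_three.2 ⟨v, a, b, h.1, h.2, hab, rfl⟩, card_neighborFinset_eq_degree] at this
  omega

/-- The colors at `b`, on edges other than `ab`, number at most `deg b - 1`. -/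
theorem exists_finset_colors [Fintype V] [DecidableEq V] {G : SimpleGraph V} [DecidableRel G.Adj]
    {c : Sym2 V → Option ℕ} {a b : V} (hab : G.Adj a b)
    (hadj : ∀ γ {v}, c s(b, v) = some γ → G.Adj b v) :
    ∃ S : Finset ℕ, (∀ v γ, v ≠ a → c s(b, v) = some γ → γ ∈ S) ∧ S.card + 1 ≤ G.degree b := by
  refine ⟨((G.neighborFinset b).erase a).image fun v => (c s(b, v)).getD 0,
    fun v γ hv h => ?_, ?_⟩
  · refine Finset.mem_image.2 ⟨v, ?_, by simp [h]⟩
    simpa [hv] using hadj γ h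
  · have h1 : a ∈ G.neighborFinset b := by simpa using hab.symm
    have h2 := Finset.card_erase_add_one h1
    rw [card_neighborFinset_eq_degree] at h2
    have h3 := Finset.card_image_le (s := (G.neighborFinset b).erase a)
      (f := fun v => (c s(b, v)).getD 0)
    omega

theorem star_eq [Fintype V] [DecidableEq V] {G : SimpleGraph V} [DecidableRel G.Adj]
    {c : Sym2 V → Option ℕ} {a b : V} {α β : ℕ} (hab : G.Adj a b) (hαβ : α ≠ β)
    (hα : α < G.maxDegree + 1) (hβ : β < G.maxDegree + 1)
    (hadj : ∀ γ {v}, c s(b, v) = some γ → G.Adj b v)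
    (hall : ∀ γ < G.maxDegree + 1, γ ≠ α → γ ≠ β → ∃ v, v ≠ a ∧ c s(b, v) = some γ) :
    (∀ γ, (∃ v, v ≠ a ∧ c s(b, v) = some γ) ↔ γ < G.maxDegree + 1 ∧ γ ≠ α ∧ γ ≠ β) ∧
      G.degree b = G.maxDegree := by
  obtain ⟨S, hS, hcard⟩ := exists_finset_colors hab hadj
  have hT : (Finset.range (G.maxDegree + 1) \ {α, β}).card + 1 = G.maxDegree := by
    rw [Finset.card_sdiff_of_subset, Finset.card_pair hαβ, Finset.card_range]
    · omega
    · intro γ; simp; omega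
  have hsub : Finset.range (G.maxDegree + 1) \ {α, β} ⊆ S := by
    intro γ hγ
    simp only [Finset.mem_sdiff, Finset.mem_range, Finset.mem_insert, Finset.mem_singleton,
      not_or] at hγ
    obtain ⟨v, h1, h2⟩ := hall γ hγ.1 hγ.2.1 hγ.2.2
    exact hS v γ h1 h2
  have hle := G.degree_le_maxDegree b
  have heq := Finset.eq_of_subset_of_card_le hsub (by omega)
  refine ⟨fun γ => ⟨fun ⟨v, h1, h2⟩ => ?_, fun h => hall γ h.1 h.2.1 h.2.2⟩, ?_⟩
  · have := hS v γ h1 h2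
    rw [← heq] at this
    simpa using this
  · have := Finset.card_le_card hsub
    omega

/-- `c` is an acyclic edge coloring of `G - xy` with colors `< k`. -/
structure IsColoringMinus (G : SimpleGraph V) (k : ℕ) (x y : V) (c : Sym2 V → Option ℕ) : Prop
    extends IsAcyclicColoring k c where
  dom : ∀ e, (c e).isSome ↔ e ∈ G.edgeSet ∧ e ≠ s(x, y)

namespace IsColoringMinus

section

variable {G : SimpleGraph V} {k : ℕ} {x y : V} {c : Sym2 V → Option ℕ}

theorem adj (h : IsColoringMinus G k x y c) {u v : V} {a : ℕ} (ha : c s(u, v) = some a) :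
    G.Adj u v :=
  ((h.dom s(u, v)).1 (by simp [ha])).1

theorem eq_none (h : IsColoringMinus G k x y c) : c s(x, y) = none := by
  have := h.dom s(x, y)
  simpa using this

theorem exists_color (h : IsColoringMinus G k x y c) {u v : V} (huv : G.Adj u v)
    (hne : s(u, v) ≠ s(x, y)) : ∃ a, c s(u, v) = some a :=
  Option.isSome_iff_exists.1 ((h.dom s(u, v)).2 ⟨huv, hne⟩)

theorem false_of_color [DecidableEq V]
    (hmin : ∀ c, IsAcyclicColoring k c → ¬ ∀ e, (c e).isSome ↔ e ∈ G.edgeSet)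
    (h : IsColoringMinus G k x y c) (hxy : G.Adj x y) {γ : ℕ}
    (hγ : IsAcyclicColoring k (Function.update c s(x, y) (some γ))) : False := by
  refine hmin _ hγ fun e => ?_
  have := h.dom e
  by_cases he : e = s(x, y)
  · subst he; simpa using hxy
  · simpa [Function.update_apply, he] using this

theorem recolor_pendant [DecidableEq V] (h : IsColoringMinus G k x y c) {y' : V} {d : ℕ}
    (hyy' : G.Adj y y') (hy'x : y' ≠ x) (hy : ∀ v, G.Adj y v → v = x ∨ v = y') (hd : d < k)
    (hfree : ∀ v, v ≠ y → c s(y', v) ≠ some d) :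
    IsColoringMinus G k x y (Function.update c s(y, y') (some d)) := by
  have honly : ∀ v a, v ≠ y' → c s(y, v) ≠ some a := by
    intro v a hv ha
    rcases hy v (h.adj ha) with rfl | rfl
    · rw [Sym2.eq_swap, h.eq_none] at ha
      cases ha
    · exact hv rfl
  refine ⟨?_, fun e => ?_⟩
  · rw [Sym2.eq_swap]
    exact h.recolor hyy'.ne' hd hfree (fun v hv => honly v d hv)
      fun a v w hv _ hva => absurd hva (honly v a hv)
  · have := h.dom e
    by_cases he : e = s(y, y')
    · subst he
      simp [hyy', hyy'.ne', hy'x]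
    · simpa [Function.update_apply, he] using this

end

variable [Fintype V] [DecidableEq V] {G : SimpleGraph V} [DecidableRel G.Adj] {x y : V}
  {c : Sym2 V → Option ℕ}

theorem exists_missing (h : IsColoringMinus G (G.maxDegree + 1) x y c) (hxy : G.Adj x y) :
    ∃ γ₁ γ₂, γ₁ ≠ γ₂ ∧ (γ₁ < G.maxDegree + 1 ∧ ∀ v, c s(x, v) ≠ some γ₁) ∧
      (γ₂ < G.maxDegree + 1 ∧ ∀ v, c s(x, v) ≠ some γ₂) := by
  obtain ⟨S, hS, hcard⟩ := exists_finset_colors (c := c) hxy.symm (fun γ => h.adj)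
  have hle := G.degree_le_maxDegree x
  have hlt : 1 < (Finset.range (G.maxDegree + 1) \ S).card := by
    have := Finset.le_card_sdiff S (Finset.range (G.maxDegree + 1))
    rw [Finset.card_range] at this
    omega
  obtain ⟨γ₁, h₁, γ₂, h₂, hne⟩ := Finset.one_lt_card.1 hlt
  have key : ∀ γ ∈ Finset.range (G.maxDegree + 1) \ S,
      γ < G.maxDegree + 1 ∧ ∀ v, c s(x, v) ≠ some γ := by
    intro γ hγ
    simp only [Finset.mem_sdiff, Finset.mem_range] at hγ
    refine ⟨hγ.1, fun v hv => ?_⟩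
    by_cases hvy : v = y
    · rw [hvy, h.eq_none] at hv
      cases hv
    · exact hγ.2 (hS v γ hvy hv)
  exact ⟨γ₁, γ₂, hne, key _ h₁, key _ h₂⟩

variable (hmin : ∀ c, IsAcyclicColoring (G.maxDegree + 1) c →
  ¬ ∀ e, (c e).isSome ↔ e ∈ G.edgeSet)

include hmin

theorem exists_other_adj (h : IsColoringMinus G (G.maxDegree + 1) x y c) (hxy : G.Adj x y) :
    ∃ v, v ≠ x ∧ G.Adj y v := by
  by_contra! hno
  obtain ⟨γ, -, -, ⟨hγ, hγx⟩, -⟩ := h.exists_missing hxy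
  exact h.false_of_color hmin hxy (h.recolor hxy.ne hγ (fun v _ => hγx v)
    (fun v hv hc => hno v hv (h.adj hc)) fun a v w hv _ hc => absurd (h.adj hc) (hno v hv))

variable {y' : V} (hxy : G.Adj x y) (hyy' : G.Adj y y') (hy'x : y' ≠ x)
  (hy : ∀ v, G.Adj y v → v = x ∨ v = y')

include hxy hy

theorem exists_big_edge (h : IsColoringMinus G (G.maxDegree + 1) x y c) {a : ℕ}
    (ha : c s(y, y') = some a) :
    ∃ w, c s(x, w) = some a ∧
      ∀ γ < G.maxDegree + 1, (∀ v, c s(x, v) ≠ some γ) → ∃ u, c s(w, u) = some γ := by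
  have honly : ∀ v b, v ≠ x → c s(y, v) = some b → b = a := by
    intro v b hv hb
    rcases hy v (h.adj hb) with rfl | rfl
    · exact absurd rfl hv
    · grind
  obtain ⟨w, hw⟩ : ∃ w, c s(x, w) = some a := by
    by_contra! hno
    obtain ⟨γ₁, γ₂, hne, h₁, h₂⟩ := h.exists_missing hxy
    obtain ⟨γ, hγa, hγ, hγx⟩ : ∃ γ, γ ≠ a ∧ γ < G.maxDegree + 1 ∧ ∀ v, c s(x, v) ≠ some γ := by
      by_cases h' : γ₁ = a
      · exact ⟨γ₂, h' ▸ hne.symm, h₂⟩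
      · exact ⟨γ₁, h', h₁⟩
    exact h.false_of_color hmin hxy (h.recolor hxy.ne hγ (fun v _ => hγx v)
      (fun v hv hc => hγa (honly v γ hv hc))
      fun b v w hv _ hc hw => absurd (honly v b hv hc ▸ hw) (hno w))
  refine ⟨w, hw, fun γ hγ hγx => ?_⟩
  by_contra! hno
  have hγa : γ ≠ a := by rintro rfl; exact hγx w hw
  refine h.false_of_color hmin hxy (h.recolor hxy.ne hγ (fun v _ => hγx v)
      (fun v hv hc => hγa (honly v γ hv hc)) fun b v w' hv _ hc hw' => ?_)
  obtain rfl := honly v b hv hc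
  rw [h.inj hw' hw]
  exact hno

theorem reachable (h : IsColoringMinus G (G.maxDegree + 1) x y c) {a γ : ℕ}
    (ha : c s(y, y') = some a) (hγ : γ < G.maxDegree + 1) (hγx : ∀ v, c s(x, v) ≠ some γ) :
    (bichrom c a γ).Reachable x y := by
  have hnone := h.eq_none
  have hupd : Function.update c s(x, y) none = c := by
    rw [← hnone, Function.update_eq_self]
  have honly : ∀ v b, c s(y, v) = some b → b = a := by
    intro v b hb
    rcases hy v (h.adj hb) with rfl | rfl
    · rw [Sym2.eq_swap, hnone] at hb
      cases hb
    · grind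
  have hγa : γ ≠ a := by
    obtain ⟨w, hw, -⟩ := h.exists_big_edge hmin hxy hy ha
    rintro rfl
    exact hγx w hw
  by_contra hno
  refine h.false_of_color hmin hxy (h.recolor_of_not_reachable hxy.ne hγ (fun v _ => hγx v)
    (fun v _ hc => hγa (honly v γ hc)) fun b => ?_)
  rw [hupd]
  by_cases hb : b = a
  · exact hb ▸ hno
  · refine not_reachable_of_isolated hxy.ne fun v hv => ?_
    rcases (bichrom_adj.1 hv).1 with hc | hc
    · exact hb (honly v b hc)
    · exact hγa (honly v γ hc)

variable {q q' : V} (hbig : ∀ w, G.Adj x w → 3 ≤ G.degree w → w = q ∨ w = q')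

include hbig

theorem color_pendant (h : IsColoringMinus G (G.maxDegree + 1) x y c) {a α β : ℕ}
    (hα : c s(x, q) = some α) (hβ : c s(x, q') = some β) (ha : c s(y, y') = some a) :
    a = α ∨ a = β := by
  obtain ⟨w, hw, hall⟩ := h.exists_big_edge hmin hxy hy ha
  obtain ⟨γ₁, γ₂, hne, ⟨h₁, h₁x⟩, ⟨h₂, h₂x⟩⟩ := h.exists_missing hxy
  obtain ⟨u₁, hu₁⟩ := hall γ₁ h₁ h₁x
  obtain ⟨u₂, hu₂⟩ := hall γ₂ h₂ h₂x
  have hdeg : 3 ≤ G.degree w := by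
    by_contra! hlt
    have hx₁ : u₁ ≠ x := by
      rintro rfl
      rw [Sym2.eq_swap] at hu₁
      exact h₁x w hu₁
    have hx₂ : u₂ ≠ x := by
      rintro rfl
      rw [Sym2.eq_swap] at hu₂
      exact h₂x w hu₂
    rcases eq_or_eq_of_degree_lt_three hlt (h.adj hw).symm (h.adj hu₁) hx₁.symm u₂ (h.adj hu₂)
      with h' | h'
    · exact hx₂ h'
    · subst h'
      rw [hu₁] at hu₂
      exact hne (Option.some.inj hu₂)
  rcases hbig w (h.adj hw) hdeg with rfl | rfl
  · left; rw [hα] at hw; exact (Option.some.inj hw).symm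
  · right; rw [hβ] at hw; exact (Option.some.inj hw).symm

include hyy' hy'x

theorem exists_at_pendant (h : IsColoringMinus G (G.maxDegree + 1) x y c) {α β : ℕ}
    (hα : c s(x, q) = some α) (hβ : c s(x, q') = some β) (γ : ℕ) (hγ : γ < G.maxDegree + 1)
    (hγα : γ ≠ α) (hγβ : γ ≠ β) : ∃ v, v ≠ y ∧ c s(y', v) = some γ := by
  by_contra! hno
  have h' := h.recolor_pendant hyy' hy'x hy hγ hno
  have hxe : ∀ v, s(x, v) ≠ s(y, y') := by
    intro v
    simp [hxy.ne, hy'x.symm]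
  have := h'.color_pendant hmin hxy hy hbig (a := γ) (α := α) (β := β)
    (by rwa [Function.update_of_ne (hxe q)]) (by rwa [Function.update_of_ne (hxe q')])
    (by simp)
  tauto

theorem exists_at_big_of_color (h : IsColoringMinus G (G.maxDegree + 1) x y c) {α β : ℕ}
    (hα : c s(x, q) = some α) (hβ : c s(x, q') = some β) (hαβ : α ≠ β) (hq : 3 ≤ G.degree q)
    (ha : c s(y, y') = some α) (η : ℕ) (hη : η < G.maxDegree + 1) (hηα : η ≠ α) (hηβ : η ≠ β) :
    ∃ v, c s(q, v) = some η := by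
  by_contra! hno
  by_cases hz : ∃ z, c s(x, z) = some η
  swap
  · push Not at hz
    obtain ⟨w, hw, hall⟩ := h.exists_big_edge hmin hxy hy ha
    obtain ⟨u, hu⟩ := hall η hη hz
    rw [h.inj hw hα] at hu
    exact hno u hu
  obtain ⟨z, hz⟩ := hz
  have hxz := h.adj hz
  have hzy : z ≠ y := by
    rintro rfl
    rw [h.eq_none] at hz
    cases hz
  have hzq : z ≠ q := by rintro rfl; grind
  have hzq' : z ≠ q' := by rintro rfl; grind
  have hqy : q ≠ y := by
    rintro rfl
    rw [h.eq_none] at hα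
    cases hα
  have hq'y : q' ≠ y := by
    rintro rfl
    rw [h.eq_none] at hβ
    cases hβ
  have hzdeg : G.degree z < 3 := by
    by_contra! h3
    rcases hbig z hxz h3 with h' | h'
    · exact hzq h'
    · exact hzq' h'
  have hzy' : z ≠ y' := by
    have := (star_eq hyy' hαβ (h.lt hα) (h.lt hβ) (fun γ => h.adj)
      (h.exists_at_pendant hmin hxy hyy' hy'x hy hbig hα hβ)).2
    have hle := G.degree_le_maxDegree q
    rintro rfl
    omega
  have hyonly : ∀ v b, c s(y, v) = some b → v = y' := by
    intro v b hb
    rcases hy v (h.adj hb) with rfl | rfl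
    · rw [Sym2.eq_swap, h.eq_none] at hb
      cases hb
    · rfl
  -- Move the color `η` from `xz` to `xy`.
  set f := Function.update (Function.update c s(x, z) none) s(x, y) (some η) with hfdef
  have hf_apply : ∀ u v, f s(u, v) = if s(u, v) = s(x, y) then some η else
      if s(u, v) = s(x, z) then none else c s(u, v) := by
    intro u v
    simp only [hfdef, Function.update_apply]
  have hf : IsColoringMinus G (G.maxDegree + 1) x z f := by
    refine ⟨?_, fun e => ?_⟩
    · have hle : ∀ {e b}, Function.update c s(x, z) none e = some b → c e = some b := by
        intro e b; grind [Function.update_apply]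
      refine (h.uncolor s(x, z)).recolor hxy.ne hη (fun v hv hc => ?_) (fun v hv hc => ?_)
        fun b v w hv hw hb hwb u hu => ?_
      · have hvz := h.inj (hle hc) hz
        subst hvz
        simp at hc
      · have hb := hle hc
        obtain rfl := hyonly v η hb
        grind
      · have hb := hle hb
        obtain rfl := hyonly v b hb
        rw [ha] at hb
        obtain rfl := Option.some.inj hb
        rw [h.inj (hle hwb) hα] at hu
        exact hno u (hle hu)
    · have := h.dom e
      have hne : s(x, y) ≠ s(x, z) := by simp [hzy.symm, hxy.ne']
      by_cases he : e = s(x, y)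
      · subst he
        simpa [hfdef, hne] using hxy
      · by_cases he' : e = s(x, z)
        · subst he'
          simp [hfdef, hne.symm]
        · simpa [hfdef, Function.update_apply, he, he'] using this
  obtain ⟨z', hz'x, hzz'⟩ := hf.exists_other_adj hmin hxz
  have hznbr : ∀ v, G.Adj z v → v = x ∨ v = z' :=
    eq_or_eq_of_degree_lt_three hzdeg hxz.symm hzz' hz'x.symm
  have hfα : f s(x, q) = some α := by
    rw [hf_apply]; simp [hqy, hzq.symm, hxy.ne, hxz.ne, hα]
  have hfβ : f s(x, q') = some β := by
    rw [hf_apply]; simp [hq'y, hzq'.symm, hxy.ne, hxz.ne, hβ]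
  have hfy : f s(y, y') = some α := by
    rw [hf_apply]; simp [hy'x, hzy.symm, hxy.ne', ha]
  have hstar := (star_eq hzz' hαβ (h.lt hα) (h.lt hβ) (fun γ => hf.adj)
    (hf.exists_at_pendant hmin hxz hzz' hz'x hznbr hbig hfα hfβ)).1
  have hzα : ∀ v, v ≠ z → f s(z', v) ≠ some α := fun v hv hc =>
    ((hstar α).1 ⟨v, hv, hc⟩).2.1 rfl
  have hczz' : c s(z, z') = some α ∨ c s(z, z') = some β := by
    obtain ⟨b, hb⟩ := hf.exists_color hzz' (by simp [hxz.ne', hz'x])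
    have := hf.color_pendant hmin hxz hznbr hbig hfα hfβ hb
    rw [hf_apply] at hb
    simp only [Sym2.eq_iff, hxz.ne', hz'x, false_and, and_false, or_self, if_false] at hb
    rcases this with rfl | rfl
    · exact Or.inl hb
    · exact Or.inr hb
  have hg := hf.recolor_pendant hzz' hz'x hznbr (h.lt hα) hzα
  set g := Function.update f s(z, z') (some α) with hgdef
  have hg_apply : ∀ u v, g s(u, v) = if s(u, v) = s(z, z') then some α else f s(u, v) := by
    intro u v
    simp only [hgdef, Function.update_apply]
  have hgx : ∀ v, g s(x, v) = f s(x, v) := by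
    intro v
    rw [hg_apply]; simp [hxz.ne, hz'x.symm]
  obtain ⟨γ, -, -, ⟨hγ, hγx⟩, -⟩ := h.exists_missing hxy
  have hγη : γ ≠ η := by rintro rfl; exact hγx z hz
  have hgγ : ∀ v, g s(x, v) ≠ some γ := by
    intro v hv
    rw [hgx, hf_apply] at hv
    have := hγx v
    grind
  have hreach_y : (bichrom c α γ).Reachable x y := h.reachable hmin hxy hy ha hγ hγx
  have hreach_z : (bichrom g α γ).Reachable x z :=
    hg.reachable hmin hxz hznbr (by simp [hgdef]) hγ hgγ
  have hle : bichrom c α γ ≤ bichrom g α γ := by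
    intro u v huv
    rw [bichrom_adj] at huv ⊢
    refine ⟨?_, huv.2⟩
    rw [hg_apply, hf_apply]
    have hnone := h.eq_none
    have := huv.1
    split_ifs with h1 h2 h3
    · simp
    · rw [h2, hnone] at this
      simp at this
    · rw [h3, hz] at this
      grind
    · exact this
  have hgη : g s(x, y) = some η := by
    rw [hgx, hf_apply]; simp
  refine not_reachable_of_three_leaves (hg.degree_le_two α γ) hxy.ne hxz.ne hzy.symm
    ?_ ?_ ?_ (hreach_y.mono hle) hreach_z
  · intro s t hs ht
    have hs := (bichrom_adj.1 hs).1.resolve_right (hgγ s)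
    have ht := (bichrom_adj.1 ht).1.resolve_right (hgγ t)
    exact hg.inj hs ht
  · have key : ∀ s, (bichrom g α γ).Adj y s → s = y' := by
      intro s hs
      have hs := (bichrom_adj.1 hs).1
      rcases hy s (hs.elim hg.adj hg.adj) with rfl | rfl
      · rw [Sym2.eq_swap, hgη] at hs
        grind
      · rfl
    exact fun s t hs ht => (key s hs).trans (key t ht).symm
  · have key : ∀ s, (bichrom g α γ).Adj z s → s = z' := by
      intro s hs
      have hs := (bichrom_adj.1 hs).1
      rcases hznbr s (hs.elim hg.adj hg.adj) with rfl | rfl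
      · rw [Sym2.eq_swap, hg.eq_none] at hs
        grind
      · rfl
    exact fun s t hs ht => (key s hs).trans (key t ht).symm

theorem exists_at_big (h : IsColoringMinus G (G.maxDegree + 1) x y c) {α β : ℕ}
    (hα : c s(x, q) = some α) (hβ : c s(x, q') = some β) (hαβ : α ≠ β) (hq : 3 ≤ G.degree q)
    (η : ℕ) (hη : η < G.maxDegree + 1) (hηα : η ≠ α) (hηβ : η ≠ β) :
    ∃ v, v ≠ x ∧ c s(q, v) = some η := by
  have hstar := (star_eq hyy' hαβ (h.lt hα) (h.lt hβ) (fun γ => h.adj)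
    (h.exists_at_pendant hmin hxy hyy' hy'x hy hbig hα hβ)).1
  have hfree : ∀ v, v ≠ y → c s(y', v) ≠ some α := fun v hv hc =>
    ((hstar α).1 ⟨v, hv, hc⟩).2.1 rfl
  have hqy' : q ≠ y' := by
    rintro rfl
    rw [Sym2.eq_swap] at hα
    exact hfree x hxy.ne hα
  have hqy : q ≠ y := by
    rintro rfl
    rw [h.eq_none] at hα
    cases hα
  have hxe : ∀ v, s(x, v) ≠ s(y, y') := by
    intro v
    simp [hxy.ne, hy'x.symm]
  have hqe : ∀ v, s(q, v) ≠ s(y, y') := by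
    intro v
    simp [hqy, hqy']
  have h' := h.recolor_pendant hyy' hy'x hy (h.lt hα) hfree
  obtain ⟨v, hv⟩ := h'.exists_at_big_of_color hmin hxy hyy' hy'x hy hbig
    (by rwa [Function.update_of_ne (hxe q)]) (by rwa [Function.update_of_ne (hxe q')])
    hαβ hq (by simp) η hη hηα hηβ
  rw [Function.update_of_ne (hqe v)] at hv
  refine ⟨v, ?_, hv⟩
  rintro rfl
  rw [Sym2.eq_swap, hα] at hv
  exact hηα (Option.some.inj hv).symm

end IsColoringMinus

/-- in the minimum-counterexample setup, with `q`, `q'` the two neighbors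
of `x` of degree at least 3, every acyclic edge coloring `c` of `G − xy` with `Δ+1`
colors satisfies `S_xq(c) = S_xq'(c) = S_{yy'}(c) = C − F''_x(c)`; in particular
`deg_G(q) = deg_G(q') = deg_G(y') = Δ`. -/
theorem Ssets_eq_compl_Fpp
    {V : Type*} [Fintype V] [DecidableEq V] (G : SimpleGraph V) [DecidableRel G.Adj]
    (h2deg : TwoDegenerate G)
    (hmin : ¬ ∃ c : Sym2 V → Option ℕ, IsAcyclicEdgeColoring G (G.maxDegree + 1) c)
    (hdel : ∀ e ∈ G.edgeSet, ∃ c : Sym2 V → Option ℕ,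
      IsAcyclicEdgeColoring (G.deleteEdges {e}) (G.maxDegree + 1) c)
    (x : V)
    (hxdeg2 : ∃ z, G.Adj x z ∧ G.degree z = 2)
    (hxdeg3 : ((G.neighborFinset x).filter fun z => 3 ≤ G.degree z).card ≤ 2)
    (y y' : V) (hxy : G.Adj x y) (hy2 : G.degree y = 2)
    (hyy' : G.Adj y y') (hy'x : y' ≠ x)
    (c : Sym2 V → Option ℕ)
    (hc : IsAcyclicEdgeColoring (G.deleteEdges {s(x, y)}) (G.maxDegree + 1) c)
    (q q' : V) (hq : G.Adj x q) (hq' : G.Adj x q') (hqq' : q ≠ q')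
    (hq3 : 3 ≤ G.degree q) (hq'3 : 3 ≤ G.degree q') :
    Sset (G.deleteEdges {s(x, y)}) c x q = Sset (G.deleteEdges {s(x, y)}) c x q' ∧
    Sset (G.deleteEdges {s(x, y)}) c x q' = Sset (G.deleteEdges {s(x, y)}) c y y' ∧
    Sset (G.deleteEdges {s(x, y)}) c y y' =
      {γ : ℕ | γ < G.maxDegree + 1} \ Fpp G c x y ∧
    G.degree q = G.maxDegree ∧ G.degree q' = G.maxDegree ∧ G.degree y' = G.maxDegree := by
  have hmin' : ∀ c, IsAcyclicColoring (G.maxDegree + 1) c →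
      ¬ ∀ e, (c e).isSome ↔ e ∈ G.edgeSet := fun c h1 h2 =>
    hmin ⟨c, isAcyclicEdgeColoring_iff.2 ⟨h1, h2⟩⟩
  have hcol : IsColoringMinus G (G.maxDegree + 1) x y c := by
    obtain ⟨h1, h2⟩ := isAcyclicEdgeColoring_iff.1 hc
    exact ⟨h1, fun e => by rw [h2, edgeSet_deleteEdges]; simp⟩
  have hbig : ∀ w, G.Adj x w → 3 ≤ G.degree w → w = q ∨ w = q' := by
    intro w hw hw3
    have heq := Finset.eq_of_subset_of_card_le (s := {q, q'})
      (t := (G.neighborFinset x).filter fun z => 3 ≤ G.degree z)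
      (by intro v; simp; rintro (rfl | rfl) <;> simp_all)
      (by rw [Finset.card_pair hqq']; exact hxdeg3)
    have : w ∈ ({q, q'} : Finset V) := by rw [heq]; simp [hw, hw3]
    simpa using this
  have hy : ∀ v, G.Adj y v → v = x ∨ v = y' :=
    eq_or_eq_of_degree_lt_three (by omega) hxy.symm hyy' hy'x.symm
  have hqy : q ≠ y := by rintro rfl; omega
  have hq'y : q' ≠ y := by rintro rfl; omega
  obtain ⟨α, hα⟩ := hcol.exists_color hq (by simp [hqy, hxy.ne])
  obtain ⟨β, hβ⟩ := hcol.exists_color hq' (by simp [hq'y, hxy.ne])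
  have hαβ : α ≠ β := by rintro rfl; exact hqq' (hcol.inj hα hβ)
  have hS : ∀ a b, Sset (G.deleteEdges {s(x, y)}) c a b =
      {γ | ∃ v, v ≠ a ∧ c s(b, v) = some γ} := by
    intro a b
    ext γ
    refine ⟨fun ⟨v, _, h⟩ => ⟨v, h⟩, fun ⟨v, h1, h2⟩ => ⟨v, ?_, h1, h2⟩⟩
    rw [← mem_edgeSet, edgeSet_deleteEdges]
    simpa using (hcol.dom s(b, v)).1 (by simp [h2])
  have hF : Fpp G c x y = {α, β} := by
    ext γ
    constructor
    · rintro ⟨v, hv, -, hv3, hvγ⟩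
      rcases hbig v hv hv3 with rfl | rfl
      · left; rw [hα] at hvγ; exact (Option.some.inj hvγ).symm
      · right; rw [hβ] at hvγ; exact (Option.some.inj hvγ).symm
    · rintro (rfl | rfl)
      · exact ⟨q, hq, hqy, hq3, hα⟩
      · exact ⟨q', hq', hq'y, hq'3, hβ⟩
  obtain ⟨h1, d1⟩ := star_eq hq hαβ (hcol.lt hα) (hcol.lt hβ) (fun γ => hcol.adj)
    (hcol.exists_at_big hmin' hxy hyy' hy'x hy hbig hα hβ hαβ hq3)
  obtain ⟨h2, d2⟩ := star_eq hq' hαβ.symm (hcol.lt hβ) (hcol.lt hα) (fun γ => hcol.adj)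
    (hcol.exists_at_big hmin' hxy hyy' hy'x hy (fun w hw hw3 => (hbig w hw hw3).symm)
      hβ hα hαβ.symm hq'3)
  obtain ⟨h3, d3⟩ := star_eq hyy' hαβ (hcol.lt hα) (hcol.lt hβ) (fun γ => hcol.adj)
    (hcol.exists_at_pendant hmin' hxy hyy' hy'x hy hbig hα hβ)
  refine ⟨?_, ?_, ?_, d1, d2, d3⟩ <;> simp only [hS, hF] <;> ext γ <;>
    simp only [Set.mem_ofPred_eq, Set.mem_sdiff, Set.mem_insert_iff, Set.mem_singleton_iff,
      h1, h2, h3] <;> tauto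

end AEC
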